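/- For every even Schwartz function ρ on ℝ and every x ∈ ℝ: ∫_ℝ (ρ(x − z) − (ρ * σ)(z)) ((ρ * Θ_x)(z))² dz = 0. -/

import Mathlib

open MeasureTheory Real

/-- `Θ_x(z) = 1_{(-∞,x]}(z) - ∫_z^∞ σ(y) dy`. -/
noncomputable def Theta (σ : ℝ → ℝ) (x z : ℝ) : ℝ :=
  Set.indicator (Set.Iic x) (fun _ => (1 : ℝ)) z - ∫ y in Set.Ioi z, σ y

open Filter Topology

theorem hasDerivAt_integral_Ioi {σ : ℝ → ℝ} (hc : Continuous σ) (hi : Integrable σ) (z : ℝ) :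
    HasDerivAt (fun z => ∫ y in Set.Ioi z, σ y) (-σ z) z := by
  have h : (fun z => ∫ y in Set.Ioi z, σ y) =
      fun z => (∫ y in Set.Ioi (0 : ℝ), σ y) - ∫ y in (0 : ℝ)..z, σ y := by
    funext z
    have := intervalIntegral.integral_interval_add_Ioi (a := (0 : ℝ)) (b := z)
      hi.integrableOn hi.integrableOn
    linarith
  rw [h]
  exact (intervalIntegral.integral_hasDerivAt_right hi.intervalIntegrable
    (hc.stronglyMeasurableAtFilter _ _) hc.continuousAt).const_sub _

theorem norm_integral_Ioi_le_one {σ : ℝ → ℝ} (hi : Integrable σ) (h0 : ∀ y, 0 ≤ σ y)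
    (h1 : ∫ y, σ y = 1) (z : ℝ) : ‖∫ y in Set.Ioi z, σ y‖ ≤ 1 := by
  rw [norm_of_nonneg (setIntegral_nonneg measurableSet_Ioi fun y _ => h0 y), ← h1]
  exact setIntegral_le_integral hi (ae_of_all _ h0)

theorem integrable_Theta {σ : ℝ → ℝ} (hc : Continuous σ) (hs : HasCompactSupport σ)
    (h0 : ∀ y, 0 ≤ σ y) (h1 : ∫ y, σ y = 1) (x : ℝ) : Integrable (Theta σ x) := by
  have hi : Integrable σ := hc.integrable_of_hasCompactSupport hs
  obtain ⟨R, hR⟩ := hs.isCompact.isBounded.subset_closedBall 0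
  have hσR : ∀ y, R < |y| → σ y = 0 := fun y hy => by
    by_contra hne
    have := hR (subset_tsupport σ hne)
    simp only [Metric.mem_closedBall, dist_zero_right, norm_eq_abs] at this
    linarith
  have hcont : Continuous fun z => ∫ y in Set.Ioi z, σ y :=
    continuous_iff_continuousAt.2 fun z => (hasDerivAt_integral_Ioi hc hi z).continuousAt
  have hmeas : AEStronglyMeasurable (Theta σ x) :=
    (((measurable_const.indicator measurableSet_Iic).sub hcont.measurable)).aestronglyMeasurable
  have hsupp : Function.support (Theta σ x) ⊆ Set.Icc (min x (-R - 1)) (max x R) := by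
    intro z hz
    by_contra hzI
    apply hz
    rw [Set.mem_Icc, not_and_or, not_le, not_le, lt_min_iff, max_lt_iff] at hzI
    rcases hzI with ⟨hx, hzR⟩ | ⟨hx, hzR⟩
    · have : ∫ y in Set.Ioi z, σ y = 1 := by
        rw [setIntegral_eq_integral_of_forall_compl_eq_zero, h1]
        intro y hy
        rw [Set.mem_Ioi, not_lt] at hy
        exact hσR y (lt_of_lt_of_le (by linarith) (neg_le_abs y))
      rw [Theta, this, Set.indicator_of_mem (Set.mem_Iic.2 hx.le), sub_self]
    · have : ∫ y in Set.Ioi z, σ y = 0 :=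
        setIntegral_eq_zero_of_forall_eq_zero fun y hy =>
          hσR y (hzR.trans ((Set.mem_Ioi.1 hy).trans_le (le_abs_self y)))
      rw [Theta, this, Set.indicator_of_notMem (by simpa using hx), sub_self]
  rw [← integrableOn_iff_integrable_of_support_subset hsupp]
  refine Measure.integrableOn_of_bounded (M := 1 + 1) measure_Icc_lt_top.ne hmeas
    (ae_of_all _ fun z => (norm_sub_le _ _).trans (add_le_add ?_ ?_))
  · exact (norm_indicator_le_norm_self _ _).trans (by simp)
  · exact norm_integral_Ioi_le_one hi h0 h1 z

theorem integral_deriv_mul_Theta {σ : ℝ → ℝ} (hc : Continuous σ) (hs : HasCompactSupport σ)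
    (h0 : ∀ y, 0 ≤ σ y) (h1 : ∫ y, σ y = 1) (ρ : SchwartzMap ℝ ℝ) (x z : ℝ) :
    ∫ w, deriv ρ (z - w) * Theta σ x w = (∫ w, ρ (z - w) * σ w) - ρ (z - x) := by
  have hi : Integrable σ := hc.integrable_of_hasCompactSupport hs
  have hS := hasDerivAt_integral_Ioi hc hi
  have hScont : Continuous fun z => ∫ y in Set.Ioi z, σ y :=
    continuous_iff_continuousAt.2 fun z => (hS z).continuousAt
  have hSbdd := norm_integral_Ioi_le_one hi h0 h1
  have hρ : Integrable fun w => ρ (z - w) := ρ.integrable.comp_sub_left z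
  have hρ' : Integrable fun w => deriv ρ (z - w) :=
    (SchwartzMap.derivCLM ℝ ℝ ρ).integrable.comp_sub_left z
  have hv : ∀ w, HasDerivAt (fun w => -ρ (z - w)) (deriv ρ (z - w)) w := fun w =>
    ((ρ.hasDerivAt (z - w)).comp_const_sub z w).neg.congr_deriv (neg_neg _)
  have hlim : Tendsto (fun w => -ρ (z - w)) atBot (𝓝 0) := by
    have : Tendsto (fun w => ρ (z - w)) atBot (𝓝 0) :=
      (ρ.tendsto_cocompact.mono_left atTop_le_cocompact).comp
        (tendsto_atTop_add_const_left _ z tendsto_neg_atBot_atTop)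
    simpa using this.neg
  have hleft : ∫ w, deriv ρ (z - w) * (Set.Iic x).indicator (fun _ => (1 : ℝ)) w =
      -ρ (z - x) := by
    have h := integral_Iic_of_hasDerivAt_of_tendsto (a := x)
      (hv x).continuousAt.continuousWithinAt (fun w _ => hv w) hρ'.integrableOn hlim
    rw [sub_zero, ← integral_indicator measurableSet_Iic] at h
    rw [← h]
    congr 1 with w
    by_cases hw : w ∈ Set.Iic x <;> simp [hw]
  have hint : Integrable fun w => (∫ y in Set.Ioi w, σ y) * deriv ρ (z - w) :=
    hρ'.bdd_mul hScont.aestronglyMeasurable (ae_of_all _ hSbdd)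
  have hright : ∫ w, (∫ y in Set.Ioi w, σ y) * deriv ρ (z - w) = -∫ w, ρ (z - w) * σ w := by
    rw [integral_mul_deriv_eq_deriv_mul_of_integrable (u' := fun w => -σ w)
      (v := fun w => -ρ (z - w)) (fun w _ => hS w) (fun w _ => hv w) hint]
    · simp [mul_comm]
    · refine hi.neg.mul_bdd (c := SchwartzMap.seminorm ℝ 0 0 ρ) ?_ (ae_of_all _ fun w => ?_)
      · exact hρ.neg.aestronglyMeasurable
      · simpa using ρ.norm_le_seminorm ℝ (z - w)
    · exact hρ.neg.bdd_mul hScont.aestronglyMeasurable (ae_of_all _ hSbdd)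
  have hint₁ : Integrable fun w =>
      deriv ρ (z - w) * (Set.Iic x).indicator (fun _ => (1 : ℝ)) w :=
    hρ'.mul_bdd (c := 1)
      (measurable_const.indicator measurableSet_Iic).aestronglyMeasurable
      (ae_of_all _ fun w => (norm_indicator_le_norm_self _ _).trans (by simp))
  calc ∫ w, deriv ρ (z - w) * Theta σ x w
      = ∫ w, (deriv ρ (z - w) * (Set.Iic x).indicator (fun _ => (1 : ℝ)) w -
          (∫ y in Set.Ioi w, σ y) * deriv ρ (z - w)) := by
        congr 1 with w
        rw [Theta]
        ring
    _ = (∫ w, ρ (z - w) * σ w) - ρ (z - x) := by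
        rw [integral_sub hint₁ hint, hleft, hright]
        ring

theorem SchwartzMap.hasDerivAt_integral_comp_sub_mul (ρ : SchwartzMap ℝ ℝ) {θ : ℝ → ℝ}
    (hθ : Integrable θ) (z : ℝ) :
    HasDerivAt (fun z => ∫ w, ρ (z - w) * θ w) (∫ w, deriv ρ (z - w) * θ w) z := by
  have hmeas (f : SchwartzMap ℝ ℝ) (z : ℝ) :
      AEStronglyMeasurable (fun w => f (z - w)) :=
    (f.continuous.comp (continuous_const.sub continuous_id)).aestronglyMeasurable
  refine (hasDerivAt_integral_of_dominated_loc_of_deriv_le univ_mem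
    (bound := fun w => SchwartzMap.seminorm ℝ 0 0 (SchwartzMap.derivCLM ℝ ℝ ρ) * ‖θ w‖)
    (F' := fun z w => deriv ρ (z - w) * θ w)
    (Eventually.of_forall fun z => (hmeas ρ z).mul hθ.aestronglyMeasurable)
    (hθ.bdd_mul (hmeas ρ z) (ae_of_all _ fun w => ρ.norm_le_seminorm ℝ (z - w)))
    ((hmeas (SchwartzMap.derivCLM ℝ ℝ ρ) z).mul hθ.aestronglyMeasurable)
    (ae_of_all _ fun w z _ => ?_) (hθ.norm.const_mul _) (ae_of_all _ fun w z _ => ?_)).2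
  · rw [norm_mul]
    exact mul_le_mul_of_nonneg_right
      ((SchwartzMap.derivCLM ℝ ℝ ρ).norm_le_seminorm ℝ (z - w)) (norm_nonneg _)
  · exact ((ρ.hasDerivAt (z - w)).comp_sub_const z w).mul_const _

theorem SchwartzMap.tendsto_integral_comp_sub_mul (ρ : SchwartzMap ℝ ℝ) {θ : ℝ → ℝ}
    (hθ : Integrable θ) :
    Tendsto (fun z => ∫ w, ρ (z - w) * θ w) (cocompact ℝ) (𝓝 0) := by
  have : (cocompact ℝ).IsCountablyGenerated := by
    rw [cocompact_eq_atBot_atTop]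
    infer_instance
  rw [show (0 : ℝ) = ∫ w, 0 * θ w by simp]
  refine tendsto_integral_filter_of_dominated_convergence
    (fun w => SchwartzMap.seminorm ℝ 0 0 ρ * ‖θ w‖) (Eventually.of_forall fun z => ?_)
    (Eventually.of_forall fun z => ae_of_all _ fun w => ?_) (hθ.norm.const_mul _)
    (ae_of_all _ fun w => Tendsto.mul_const _ ?_)
  · exact (ρ.continuous.comp
      (continuous_const.sub continuous_id)).aestronglyMeasurable.mul hθ.aestronglyMeasurable
  · rw [norm_mul]
    exact mul_le_mul_of_nonneg_right (ρ.norm_le_seminorm ℝ (z - w)) (norm_nonneg _)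
  · exact ρ.tendsto_cocompact.comp (Homeomorph.subRight w).isClosedEmbedding.tendsto_cocompact

theorem integral_deriv_mul_sq_eq_zero {F F' : ℝ → ℝ} (hF : ∀ z, HasDerivAt F (F' z) z)
    (hlim : Tendsto F (cocompact ℝ) (𝓝 0)) : ∫ z, F' z * F z ^ 2 = 0 := by
  by_cases hint : Integrable fun z => F' z * F z ^ 2
  · have hlim3 : Tendsto (fun z => F z ^ 3 / 3) (cocompact ℝ) (𝓝 0) := by
      simpa using (hlim.pow 3).div_const 3
    have h := integral_of_hasDerivAt_of_tendsto (f := fun z => F z ^ 3 / 3)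
      (fun z => (((hF z).pow 3).div_const 3).congr_deriv (by push_cast; ring)) hint
      (hlim3.mono_left atBot_le_cocompact) (hlim3.mono_left atTop_le_cocompact)
    simpa using h
  · exact integral_undef hint

theorem stmt_5 (σ : ℝ → ℝ) (hσ_smooth : ContDiff ℝ (⊤ : ℕ∞) σ) (hσ_supp : HasCompactSupport σ)
    (hσ_nonneg : ∀ y, 0 ≤ σ y) (hσ_int : ∫ y, σ y = 1)
    (ρ : SchwartzMap ℝ ℝ) (hρ_even : ∀ y, ρ (-y) = ρ y) (x : ℝ) :
    ∫ z, (ρ (x - z) - ∫ w, ρ (z - w) * σ w) * (∫ w, ρ (z - w) * Theta σ x w) ^ 2 = 0 := by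
  have hc := hσ_smooth.continuous
  have hθ := integrable_Theta hc hσ_supp hσ_nonneg hσ_int x
  have h := integral_deriv_mul_sq_eq_zero (ρ.hasDerivAt_integral_comp_sub_mul hθ)
    (ρ.tendsto_integral_comp_sub_mul hθ)
  rw [← neg_eq_zero, ← integral_neg, ← h]
  congr 1 with z
  rw [integral_deriv_mul_Theta hc hσ_supp hσ_nonneg hσ_int, ← hρ_even (z - x), neg_sub]
  ring
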